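/- Let A, B, C be jointly distributed discrete random variables taking finitely many values in a field (or a ring with no zero divisors), and assume A never takes the value 0. Then H(A(B + C)) + H(A, B, C) ≤ H(A, B + C) + H(AB, AC). If A, B, C are i.i.d., then H(A(B + C)) ≤ 2 H(AB) + H(A + B) − 2 H(A). -/

import Mathlib

/-- The probability of the event `E` under the probability mass function `p`
on a finite sample space. -/
noncomputable def prob {Ω : Type*} [Fintype Ω] (p : Ω → ℝ) (E : Set Ω) : ℝ :=
  ∑ ω, E.indicator p ω

/-- The Shannon entropy (base 2) of the discrete random variable `X` on the finite
probability space given by the probability mass function `p`. -/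
noncomputable def ent {Ω S : Type*} [Fintype Ω] (p : Ω → ℝ) (X : Ω → S) : ℝ :=
  letI := Classical.decEq S
  ∑ v ∈ Finset.univ.image X,
      -(prob p {ω | X ω = v} * Real.logb 2 (prob p {ω | X ω = v}))

section Helpers

open Classical in
lemma prob_eq_sum {Ω : Type*} [Fintype Ω] (p : Ω → ℝ) (E : Set Ω) :
    prob p E = ∑ ω, if ω ∈ E then p ω else 0 := by
  unfold prob
  refine Finset.sum_congr rfl fun ω _ => ?_
  simp [Set.indicator_apply]

lemma prob_nonneg' {Ω : Type*} [Fintype Ω] (p : Ω → ℝ) (hp : ∀ ω, 0 ≤ p ω) (E : Set Ω) :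
    0 ≤ prob p E :=
  Finset.sum_nonneg fun ω _ => Set.indicator_nonneg (fun x _ => hp x) ω

lemma le_prob {Ω : Type*} [Fintype Ω] (p : Ω → ℝ) (hp : ∀ ω, 0 ≤ p ω) (E : Set Ω) (ω : Ω)
    (h : ω ∈ E) : p ω ≤ prob p E := by
  unfold prob
  have := Finset.single_le_sum (f := fun x => E.indicator p x)
    (fun x _ => Set.indicator_nonneg (fun x _ => hp x) x) (Finset.mem_univ ω)
  simpa [Set.indicator_of_mem h] using this

/-- Grouping by fibres. -/
lemma sum_fibre {Ω S : Type*} [Fintype Ω] [DecidableEq S] (p : Ω → ℝ) (X : Ω → S)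
    (T : Finset S) (hT : ∀ ω, X ω ∈ T) (g : S → ℝ) :
    ∑ ω, p ω * g (X ω) = ∑ v ∈ T, prob p {ω | X ω = v} * g v := by
  simp_rw [prob_eq_sum, Finset.sum_mul]
  rw [Finset.sum_comm]
  refine Finset.sum_congr rfl fun ω _ => ?_
  simp [hT]

lemma ent_eq_point {Ω S : Type*} [Fintype Ω] (p : Ω → ℝ) (X : Ω → S) :
    ent p X = - ∑ ω, p ω * Real.logb 2 (prob p {ω' | X ω' = X ω}) := by
  classical
  rw [sum_fibre p X (Finset.univ.image X) (by simp)
    (fun v => Real.logb 2 (prob p {ω' | X ω' = v})), ← Finset.sum_neg_distrib]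
  unfold ent
  refine Finset.sum_congr ?_ fun _ _ => rfl
  ext; simp

lemma law_comp {Ω S U : Type*} [Fintype Ω] (p : Ω → ℝ) (X Y : Ω → S)
    (h : ∀ v, prob p {ω | X ω = v} = prob p {ω | Y ω = v}) (f : S → U) (r : U) :
    prob p {ω | f (X ω) = r} = prob p {ω | f (Y ω) = r} := by
  classical
  have key : ∀ Z : Ω → S, prob p {ω | f (Z ω) = r} =
      ∑ ω, p ω * (fun v => if f v = r then (1 : ℝ) else 0) (Z ω) := by
    intro Z
    rw [prob_eq_sum]
    simp
  rw [key X, key Y, sum_fibre p X (Finset.univ.image X ∪ Finset.univ.image Y) (by simp)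
      (fun v => if f v = r then (1 : ℝ) else 0),
    sum_fibre p Y (Finset.univ.image X ∪ Finset.univ.image Y) (by simp)
      (fun v => if f v = r then (1 : ℝ) else 0)]
  simp_rw [h]

lemma ent_law {Ω S : Type*} [Fintype Ω] (p : Ω → ℝ) (X Y : Ω → S)
    (h : ∀ v, prob p {ω | X ω = v} = prob p {ω | Y ω = v}) : ent p X = ent p Y := by
  classical
  rw [ent_eq_point, ent_eq_point,
    sum_fibre p X (Finset.univ.image X ∪ Finset.univ.image Y) (by simp)
      (fun v => Real.logb 2 (prob p {ω' | X ω' = v})),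
    sum_fibre p Y (Finset.univ.image X ∪ Finset.univ.image Y) (by simp)
      (fun v => Real.logb 2 (prob p {ω' | Y ω' = v}))]
  simp_rw [h]

lemma ent_congr_ae {Ω S U : Type*} [Fintype Ω] (p : Ω → ℝ) (X : Ω → S) (Y : Ω → U)
    (h : ∀ ω ω', p ω ≠ 0 → p ω' ≠ 0 → (X ω = X ω' ↔ Y ω = Y ω')) : ent p X = ent p Y := by
  classical
  rw [ent_eq_point, ent_eq_point]
  congr 1
  refine Finset.sum_congr rfl fun ω _ => ?_
  by_cases hω : p ω = 0
  · simp [hω]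
  congr 2
  rw [prob_eq_sum, prob_eq_sum]
  refine Finset.sum_congr rfl fun ω' _ => ?_
  by_cases hω' : p ω' = 0
  · simp [hω']
  simp [h ω' ω hω' hω]

/-- Submodularity. -/
lemma ent_submod {Ω S U V : Type*} [Fintype Ω] (p : Ω → ℝ) (hp : ∀ ω, 0 ≤ p ω)
    (hp1 : ∑ ω, p ω = 1) (X : Ω → S) (Y : Ω → U) (Z : Ω → V)
    (hX : ∀ ω ω', X ω = X ω' → Z ω = Z ω') (hY : ∀ ω ω', Y ω = Y ω' → Z ω = Z ω') :
    ent p Z + ent p (fun ω => (X ω, Y ω)) ≤ ent p X + ent p Y := by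
  classical
  set qX : Ω → ℝ := fun ω => prob p {ω' | X ω' = X ω} with hqX
  set qY : Ω → ℝ := fun ω => prob p {ω' | Y ω' = Y ω} with hqY
  set qZ : Ω → ℝ := fun ω => prob p {ω' | Z ω' = Z ω} with hqZ
  set qW : Ω → ℝ := fun ω => prob p {ω' | (X ω', Y ω') = (X ω, Y ω)} with hqW
  have nX : ∀ ω, 0 ≤ qX ω := fun ω => prob_nonneg' p hp _
  have nY : ∀ ω, 0 ≤ qY ω := fun ω => prob_nonneg' p hp _
  have nZ : ∀ ω, 0 ≤ qZ ω := fun ω => prob_nonneg' p hp _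
  have nW : ∀ ω, 0 ≤ qW ω := fun ω => prob_nonneg' p hp _
  have lX : ∀ ω, p ω ≤ qX ω := fun ω => le_prob p hp _ ω rfl
  have lY : ∀ ω, p ω ≤ qY ω := fun ω => le_prob p hp _ ω rfl
  have lZ : ∀ ω, p ω ≤ qZ ω := fun ω => le_prob p hp _ ω rfl
  have lW : ∀ ω, p ω ≤ qW ω := fun ω => le_prob p hp _ ω rfl
  -- the key bound
  have inner : ∀ ω₁ ω₂, (∑ ω, p ω / (qW ω * qZ ω) *
      ((if X ω₁ = X ω then 1 else 0) * (if Y ω₂ = Y ω then 1 else 0))) ≤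
      if Z ω₂ = Z ω₁ then 1 / qZ ω₁ else 0 := by
    intro ω₁ ω₂
    by_cases hex : ∃ ω₀, X ω₁ = X ω₀ ∧ Y ω₂ = Y ω₀
    · obtain ⟨ω₀, h1, h2⟩ := hex
      have hz1 : Z ω₁ = Z ω₀ := hX _ _ h1
      have hz2 : Z ω₂ = Z ω₀ := hY _ _ h2
      rw [if_pos (hz2.trans hz1.symm)]
      have hzq : qZ ω₁ = qZ ω₀ := by simp only [hqZ, hz1]
      have e : ∀ ω, p ω / (qW ω * qZ ω) *
          ((if X ω₁ = X ω then 1 else 0) * (if Y ω₂ = Y ω then 1 else 0)) =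
          (if (X ω, Y ω) = (X ω₀, Y ω₀) then p ω else 0) * (1 / (qW ω₀ * qZ ω₀)) := by
        intro ω
        by_cases hh : X ω = X ω₀ ∧ Y ω = Y ω₀
        · have hz : Z ω = Z ω₀ := hX _ _ hh.1
          have a1 : qW ω = qW ω₀ := by simp only [hqW, hh.1, hh.2]
          have a2 : qZ ω = qZ ω₀ := by simp only [hqZ, hz]
          rw [a1, a2, h1, h2]
          simp [hh.1, hh.2]
          ring
        · rw [h1, h2]
          have : ¬ (X ω, Y ω) = (X ω₀, Y ω₀) := by simpa using hh
          rw [if_neg this]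
          by_cases h3 : X ω₀ = X ω
          · have : ¬ Y ω₀ = Y ω := fun h4 => hh ⟨h3.symm, h4.symm⟩
            simp [this]
          · simp [h3]
      rw [Finset.sum_congr rfl fun ω _ => e ω, ← Finset.sum_mul, hzq]
      have : (∑ ω, if (X ω, Y ω) = (X ω₀, Y ω₀) then p ω else 0) = qW ω₀ := by
        simp only [hqW]
        rw [prob_eq_sum]
        refine Finset.sum_congr rfl fun ω _ => ?_
        simp
      rw [this]
      by_cases hw : qW ω₀ = 0
      · simp [hw, nZ]
      · apply le_of_eq
        by_cases hz : qZ ω₀ = 0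
        · simp [hz]
        · field_simp
    · rw [Finset.sum_eq_zero]
      · split_ifs
        · exact div_nonneg zero_le_one (nZ _)
        · exact le_rfl
      · intro ω _
        by_cases h3 : X ω₁ = X ω
        · have : ¬ Y ω₂ = Y ω := fun h4 => hex ⟨ω, h3, h4⟩
          simp [this]
        · simp [h3]
  have key : ∑ ω, p ω / (qW ω * qZ ω) * (qX ω * qY ω) ≤ 1 := by
    have eX : ∀ ω, qX ω = ∑ ω₁, p ω₁ * (if X ω₁ = X ω then 1 else 0) := by
      intro ω; simp only [hqX]; rw [prob_eq_sum]; simp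
    have eY : ∀ ω, qY ω = ∑ ω₁, p ω₁ * (if Y ω₁ = Y ω then 1 else 0) := by
      intro ω; simp only [hqY]; rw [prob_eq_sum]; simp
    have eZ : ∀ ω, qZ ω = ∑ ω₁, p ω₁ * (if Z ω₁ = Z ω then 1 else 0) := by
      intro ω; simp only [hqZ]; rw [prob_eq_sum]; simp
    calc ∑ ω, p ω / (qW ω * qZ ω) * (qX ω * qY ω)
        = ∑ ω, ∑ ω₁, ∑ ω₂, p ω₁ * (p ω₂ * (p ω / (qW ω * qZ ω) *
          ((if X ω₁ = X ω then 1 else 0) * (if Y ω₂ = Y ω then 1 else 0)))) := by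
          refine Finset.sum_congr rfl fun ω _ => ?_
          rw [eX, eY, Finset.sum_mul_sum, Finset.mul_sum]
          refine Finset.sum_congr rfl fun ω₁ _ => ?_
          rw [Finset.mul_sum]
          refine Finset.sum_congr rfl fun ω₂ _ => ?_
          ring
      _ = ∑ ω₁, ∑ ω₂, p ω₁ * (p ω₂ * ∑ ω, p ω / (qW ω * qZ ω) *
          ((if X ω₁ = X ω then 1 else 0) * (if Y ω₂ = Y ω then 1 else 0))) := by
          rw [Finset.sum_comm]
          refine Finset.sum_congr rfl fun ω₁ _ => ?_
          rw [Finset.sum_comm]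
          refine Finset.sum_congr rfl fun ω₂ _ => ?_
          rw [Finset.mul_sum, Finset.mul_sum]
      _ ≤ ∑ ω₁, ∑ ω₂, p ω₁ * (p ω₂ * (if Z ω₂ = Z ω₁ then 1 / qZ ω₁ else 0)) := by
          refine Finset.sum_le_sum fun ω₁ _ => Finset.sum_le_sum fun ω₂ _ => ?_
          exact mul_le_mul_of_nonneg_left
            (mul_le_mul_of_nonneg_left (inner ω₁ ω₂) (hp _)) (hp _)
      _ = ∑ ω₁, p ω₁ * (qZ ω₁ * (1 / qZ ω₁)) := by
          refine Finset.sum_congr rfl fun ω₁ _ => ?_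
          rw [← Finset.mul_sum]
          congr 1
          conv_rhs => rw [eZ ω₁, Finset.sum_mul, ← eZ ω₁]
          refine Finset.sum_congr rfl fun ω₂ _ => ?_
          split_ifs <;> simp
      _ ≤ ∑ ω₁, p ω₁ := by
          refine Finset.sum_le_sum fun ω₁ _ => ?_
          by_cases hz : qZ ω₁ = 0
          · simp [hz, hp]
          · rw [mul_one_div_cancel hz, mul_one]
      _ = 1 := hp1
  have l2 : 0 < Real.log 2 := Real.log_pos one_lt_two
  have pt : ∀ ω, p ω * (Real.logb 2 (qX ω) + Real.logb 2 (qY ω)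
      - Real.logb 2 (qZ ω) - Real.logb 2 (qW ω)) ≤
      (p ω / (qW ω * qZ ω) * (qX ω * qY ω) - p ω) / Real.log 2 := by
    intro ω
    rcases (hp ω).eq_or_lt with h0 | h0
    · simp [← h0]
    · have pX := h0.trans_le (lX ω)
      have pY := h0.trans_le (lY ω)
      have pZ := h0.trans_le (lZ ω)
      have pW := h0.trans_le (lW ω)
      have hl := Real.log_le_sub_one_of_pos
        (show 0 < (qX ω * qY ω) / (qZ ω * qW ω) by positivity)
      rw [Real.log_div (by positivity) (by positivity), Real.log_mul pX.ne' pY.ne',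
        Real.log_mul pZ.ne' pW.ne'] at hl
      rw [le_div_iff₀ l2]
      have e1 : p ω * (Real.logb 2 (qX ω) + Real.logb 2 (qY ω)
          - Real.logb 2 (qZ ω) - Real.logb 2 (qW ω)) * Real.log 2 =
          p ω * (Real.log (qX ω) + Real.log (qY ω)
            - (Real.log (qZ ω) + Real.log (qW ω))) := by
        simp only [Real.logb]
        field_simp
        ring
      rw [e1]
      refine (mul_le_mul_of_nonneg_left hl h0.le).trans (le_of_eq ?_)
      field_simp
  have tot : ∑ ω, p ω * (Real.logb 2 (qX ω) + Real.logb 2 (qY ω)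
      - Real.logb 2 (qZ ω) - Real.logb 2 (qW ω)) ≤ 0 := by
    refine (Finset.sum_le_sum fun ω _ => pt ω).trans ?_
    rw [← Finset.sum_div, Finset.sum_sub_distrib, hp1]
    exact div_nonpos_of_nonpos_of_nonneg (by linarith) l2.le
  rw [ent_eq_point p X, ent_eq_point p Y, ent_eq_point p Z, ent_eq_point p (fun ω => (X ω, Y ω))]
  simp only [mul_sub, mul_add, Finset.sum_sub_distrib, Finset.sum_add_distrib] at tot
  linarith

lemma ent_subadd {Ω S U : Type*} [Fintype Ω] (p : Ω → ℝ) (hp : ∀ ω, 0 ≤ p ω)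
    (hp1 : ∑ ω, p ω = 1) (X : Ω → S) (Y : Ω → U) :
    ent p (fun ω => (X ω, Y ω)) ≤ ent p X + ent p Y := by
  have h := ent_submod p hp hp1 X Y (fun _ => ()) (fun _ _ _ => rfl) (fun _ _ _ => rfl)
  have h0 : ent p (fun _ : Ω => ()) = 0 := by
    rw [ent_eq_point]
    simp [prob, hp1]
  linarith

end Helpers

theorem entropy_sum_product_step {Ω R : Type*} [Fintype Ω] [CommRing R] [NoZeroDivisors R]
    (p : Ω → ℝ) (hp : ∀ ω, 0 ≤ p ω) (hp1 : ∑ ω, p ω = 1) (A B C : Ω → R)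
    (hA0 : prob p {ω | A ω = 0} = 0) :
    (ent p (fun ω => A ω * (B ω + C ω)) + ent p (fun ω => (A ω, B ω, C ω)) ≤
      ent p (fun ω => (A ω, B ω + C ω)) + ent p (fun ω => (A ω * B ω, A ω * C ω))) ∧
    ((∀ a b c : R, prob p {ω | A ω = a ∧ B ω = b ∧ C ω = c} =
        prob p {ω | A ω = a} * prob p {ω | B ω = b} * prob p {ω | C ω = c}) →
      (∀ r : R, prob p {ω | B ω = r} = prob p {ω | A ω = r}) →
      (∀ r : R, prob p {ω | C ω = r} = prob p {ω | A ω = r}) →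
      ent p (fun ω => A ω * (B ω + C ω)) ≤
        2 * ent p (fun ω => A ω * B ω) + ent p (fun ω => A ω + B ω) - 2 * ent p A) := by
  have hA : ∀ ω, p ω ≠ 0 → A ω ≠ 0 := by
    intro ω hω h
    have := le_prob p hp {ω | A ω = 0} ω h
    exact hω (le_antisymm (this.trans hA0.le) (hp ω))
  have part1 : ent p (fun ω => A ω * (B ω + C ω)) + ent p (fun ω => (A ω, B ω, C ω)) ≤
      ent p (fun ω => (A ω, B ω + C ω)) + ent p (fun ω => (A ω * B ω, A ω * C ω)) := by
    have h := ent_submod p hp hp1 (fun ω => (A ω, B ω + C ω)) (fun ω => (A ω * B ω, A ω * C ω))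
      (fun ω => A ω * (B ω + C ω))
      (by
        intro ω ω' h
        simp only [Prod.mk.injEq] at h
        simp only [h.1, h.2])
      (by
        intro ω ω' h
        simp only [Prod.mk.injEq] at h
        simp only [mul_add, h.1, h.2])
    have e : ent p (fun ω => (A ω, B ω, C ω)) =
        ent p (fun ω => ((A ω, B ω + C ω), (A ω * B ω, A ω * C ω))) := by
      apply ent_congr_ae
      intro ω ω' h1 h2
      simp only [Prod.mk.injEq]
      constructor
      · rintro ⟨a, b, c⟩
        simp [a, b, c]
      · rintro ⟨⟨a, -⟩, b, c⟩
        rw [a] at b c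
        exact ⟨a, mul_left_cancel₀ (hA ω' h2) b, mul_left_cancel₀ (hA ω' h2) c⟩
    rw [e]
    exact h
  refine ⟨part1, fun hind hB hC => ?_⟩
  have hlaw : ∀ a b c : R, prob p {ω | A ω = a ∧ B ω = b ∧ C ω = c} =
      prob p {ω | A ω = a} * prob p {ω | A ω = b} * prob p {ω | A ω = c} := by
    intro a b c
    rw [hind, hB, hC]
  have hBC : ent p (fun ω => B ω + C ω) = ent p (fun ω => A ω + B ω) := by
    apply ent_law
    refine law_comp p (fun ω => (B ω, C ω, A ω)) (fun ω => (A ω, B ω, C ω)) ?_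
      (fun t => t.1 + t.2.1)
    rintro ⟨a, b, c⟩
    have e1 : {ω | (B ω, C ω, A ω) = (a, b, c)} = {ω | A ω = c ∧ B ω = a ∧ C ω = b} := by
      ext ω; simp only [Set.mem_ofPred_eq, Prod.mk.injEq]; tauto
    have e2 : {ω | (A ω, B ω, C ω) = (a, b, c)} = {ω | A ω = a ∧ B ω = b ∧ C ω = c} := by
      ext ω; simp only [Set.mem_ofPred_eq, Prod.mk.injEq]
    rw [e1, e2, hlaw, hlaw]
    ring
  have hAC : ent p (fun ω => A ω * C ω) = ent p (fun ω => A ω * B ω) := by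
    apply ent_law
    refine law_comp p (fun ω => (A ω, C ω, B ω)) (fun ω => (A ω, B ω, C ω)) ?_
      (fun t => t.1 * t.2.1)
    rintro ⟨a, b, c⟩
    have e1 : {ω | (A ω, C ω, B ω) = (a, b, c)} = {ω | A ω = a ∧ B ω = c ∧ C ω = b} := by
      ext ω; simp only [Set.mem_ofPred_eq, Prod.mk.injEq]; tauto
    have e2 : {ω | (A ω, B ω, C ω) = (a, b, c)} = {ω | A ω = a ∧ B ω = b ∧ C ω = c} := by
      ext ω; simp only [Set.mem_ofPred_eq, Prod.mk.injEq]
    rw [e1, e2, hlaw, hlaw]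
    ring
  have hEB : ent p B = ent p A := ent_law p B A hB
  have hEC : ent p C = ent p A := ent_law p C A hC
  have h3 : ent p (fun ω => (A ω, B ω, C ω)) = ent p A + ent p B + ent p C := by
    rw [ent_eq_point, ent_eq_point p A, ent_eq_point p B, ent_eq_point p C, ← neg_add, ← neg_add,
      ← Finset.sum_add_distrib, ← Finset.sum_add_distrib]
    congr 1
    refine Finset.sum_congr rfl fun ω _ => ?_
    rcases (hp ω).eq_or_lt with h0 | h0
    · simp [← h0]
    · have e2 : {ω' | (A ω', B ω', C ω') = (A ω, B ω, C ω)} =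
          {ω' | A ω' = A ω ∧ B ω' = B ω ∧ C ω' = C ω} := by
        ext ω; simp only [Set.mem_ofPred_eq, Prod.mk.injEq]
      have pA := h0.trans_le (le_prob p hp {ω' | A ω' = A ω} ω rfl)
      have pB := h0.trans_le (le_prob p hp {ω' | B ω' = B ω} ω rfl)
      have pC := h0.trans_le (le_prob p hp {ω' | C ω' = C ω} ω rfl)
      rw [e2, hind, Real.logb_mul (mul_pos pA pB).ne' pC.ne', Real.logb_mul pA.ne' pB.ne']
      ring
  have s1 := ent_subadd p hp hp1 A (fun ω => B ω + C ω)
  have s2 := ent_subadd p hp hp1 (fun ω => A ω * B ω) (fun ω => A ω * C ω)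
  linarith
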